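/- arXiv:1702.03444 — 3 statements merged into one kernel-verified Lean document; each statement's English description precedes it below -/
import Mathlib

section
/- Let γ > 0, let T be an η×η real matrix with nonnegative off-diagonal entries all of whose complex eigenvalues have negative real part, and let α ∈ ℝ^{1×η} be entrywise nonnegative with α e_η = 1. Set ω = 1 + γ α (T - γ I_η)^{-1} e_η and assume ω < 1. Then the row vector α₁ = (γ/(1-ω)) · α (γ I_η - T)^{-1} has all entries nonnegative and satisfies α₁ e_η = 1; hence (α₁, T) is a valid phase-type representation. -/
open MeasureTheory Matrix

/-- Every complex eigenvalue (root of the complex characteristic polynomial) of the real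
matrix `T` has negative real part. -/
def NegStable {ι : Type*} [Fintype ι] [DecidableEq ι] (T : Matrix ι ι ℝ) : Prop :=
  ∀ z : ℂ, (T.map (Complex.ofReal)).charpoly.IsRoot z → z.re < 0

/-- A stable matrix has an invertible resolvent `s • 1 - T` at every real `s ≥ 0`. -/
theorem NegStable.det_smul_one_sub_ne_zero {ι : Type*} [Fintype ι] [DecidableEq ι]
    {T : Matrix ι ι ℝ} (hT : NegStable T) {s : ℝ} (hs : 0 ≤ s) :
    (s • (1 : Matrix ι ι ℝ) - T).det ≠ 0 := by
  intro h
  have hroot : T.charpoly.IsRoot s := by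
    rw [Polynomial.IsRoot.def, Matrix.eval_charpoly, ← h, Matrix.smul_one_eq_diagonal]
    rfl
  have hre := hT (s : ℂ) (by
    have hmap := hroot.map (f := Complex.ofRealHom)
    rw [← Matrix.charpoly_map] at hmap
    exact hmap)
  simp only [Complex.ofReal_re] at hre
  linarith

/-- If `x` is minimal at `i` and `T` is Metzler, then `((s • 1 - T) x) i` is at most
`(s - ∑ j, T i j) * x i`. -/
theorem smul_one_sub_mulVec_le_of_forall_le {ι : Type*} [Fintype ι] [DecidableEq ι]
    {T : Matrix ι ι ℝ} (hM : ∀ i j, i ≠ j → 0 ≤ T i j) (s : ℝ) {x : ι → ℝ} {i : ι}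
    (hi : ∀ j, x i ≤ x j) :
    ((s • (1 : Matrix ι ι ℝ) - T) *ᵥ x) i ≤ (s - ∑ j, T i j) * x i := by
  have hle : ∑ j, T i j * x i ≤ ∑ j, T i j * x j := by
    refine Finset.sum_le_sum fun j _ => ?_
    rcases eq_or_ne i j with rfl | hij
    · exact le_rfl
    · exact mul_le_mul_of_nonneg_left (hi j) (hM i j hij)
  have heq : ((s • (1 : Matrix ι ι ℝ) - T) *ᵥ x) i = s * x i - ∑ j, T i j * x j := by
    rw [Matrix.sub_mulVec, Matrix.smul_mulVec, Matrix.one_mulVec]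
    rfl
  rw [heq, sub_mul, Finset.sum_mul]
  linarith

/-- The resolvent of a stable Metzler matrix maps positive vectors to positive vectors. -/
theorem NegStable.resolvent_mulVec_pos {ι : Type*} [Fintype ι] [DecidableEq ι]
    {T : Matrix ι ι ℝ} (hT : NegStable T) (hM : ∀ i j, i ≠ j → 0 ≤ T i j)
    {γ : ℝ} (hγ : 0 ≤ γ) {v : ι → ℝ} (hv : ∀ i, 0 < v i) (i : ι) :
    0 < ((γ • (1 : Matrix ι ι ℝ) - T)⁻¹ *ᵥ v) i := by
  have hne : (Finset.univ : Finset ι).Nonempty := ⟨i, Finset.mem_univ i⟩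
  let x : ℝ → ι → ℝ := fun s => (s • (1 : Matrix ι ι ℝ) - T)⁻¹ *ᵥ v
  let m : ℝ → ℝ := fun s => Finset.univ.inf' hne (x s)
  have hx : ∀ s, 0 ≤ s → (s • (1 : Matrix ι ι ℝ) - T) *ᵥ x s = v := fun s hs => by
    rw [Matrix.mulVec_mulVec, Matrix.mul_nonsing_inv _ (hT.det_smul_one_sub_ne_zero hs).isUnit,
      Matrix.one_mulVec]
  have hmin : ∀ s, 0 ≤ s → ∃ k, 0 < (s - ∑ j, T k j) * m s := fun s hs => by
    obtain ⟨k, -, hk⟩ := Finset.exists_mem_eq_inf' hne (x s)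
    refine ⟨k, ?_⟩
    have hle := smul_one_sub_mulVec_le_of_forall_le hM s (x := x s) (i := k)
      fun j => hk ▸ Finset.inf'_le _ (Finset.mem_univ j)
    rw [hx s hs, ← hk] at hle
    exact (hv k).trans_le hle
  have hcont : ContinuousOn m (Set.Ici 0) := by
    refine ContinuousOn.finset_inf'_apply hne fun k _ => ?_
    have hA : Continuous fun s : ℝ => s • (1 : Matrix ι ι ℝ) - T := by fun_prop
    have hadj : Continuous fun s : ℝ => ((s • (1 : Matrix ι ι ℝ) - T).adjugate *ᵥ v) k :=
      (continuous_apply k).comp (hA.matrix_adjugate.matrix_mulVec continuous_const)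
    refine ((hA.matrix_det.continuousOn.inv₀
      fun s hs => hT.det_smul_one_sub_ne_zero hs).mul hadj.continuousOn).congr fun s _ => ?_
    simp only [Matrix.inv_def, Ring.inverse_eq_inv', Matrix.smul_mulVec, Pi.smul_apply,
      smul_eq_mul, Pi.mul_apply, Pi.inv_apply]
  obtain ⟨S, hγS, hS⟩ : ∃ S, γ ≤ S ∧ ∀ k, ∑ j, T k j ≤ S := by
    obtain ⟨B, hB⟩ := (Set.finite_range fun k => ∑ j, T k j).bddAbove
    exact ⟨max γ B, le_max_left _ _, fun k => (hB ⟨k, rfl⟩).trans (le_max_right _ _)⟩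
  have hmS : 0 < m S := by
    obtain ⟨k, hk⟩ := hmin S (hγ.trans hγS)
    exact pos_of_mul_pos_right hk (sub_nonneg.2 (hS k))
  have hmγ : 0 < m γ := by
    by_contra! hneg
    obtain ⟨s, hs, hs0⟩ := intermediate_value_Icc hγS
      (hcont.mono fun s hs => hγ.trans hs.1) ⟨hneg, hmS.le⟩
    obtain ⟨k, hk⟩ := hmin s (hγ.trans hs.1)
    simp [hs0] at hk
  exact hmγ.trans_le (Finset.inf'_le _ (Finset.mem_univ i))

/-- The resolvent of a stable Metzler matrix is entrywise nonnegative. -/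
theorem NegStable.resolvent_nonneg {ι : Type*} [Fintype ι] [DecidableEq ι]
    {T : Matrix ι ι ℝ} (hT : NegStable T) (hM : ∀ i j, i ≠ j → 0 ≤ T i j)
    {γ : ℝ} (hγ : 0 ≤ γ) (i j : ι) : 0 ≤ (γ • (1 : Matrix ι ι ℝ) - T)⁻¹ i j := by
  set R := (γ • (1 : Matrix ι ι ℝ) - T)⁻¹ with hR
  have hr : 0 < (R *ᵥ 1) i := hT.resolvent_mulVec_pos hM hγ (fun _ => one_pos) i
  by_contra! hneg
  have hε : 0 < -R i j / (R *ᵥ 1) i := div_pos (neg_pos.2 hneg) hr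
  have hpos := hT.resolvent_mulVec_pos hM hγ
    (v := Pi.single j 1 + (-R i j / (R *ᵥ 1) i) • 1) (fun k => by
      have h0 : (0 : ℝ) ≤ (Pi.single j 1 : ι → ℝ) k :=
        (Pi.single_nonneg.2 zero_le_one : (0 : ι → ℝ) ≤ Pi.single j 1) k
      simpa using add_pos_of_nonneg_of_pos h0 hε) i
  rw [← hR, Matrix.mulVec_add, Matrix.mulVec_smul, Matrix.mulVec_single_one] at hpos
  simp [div_mul_cancel₀ _ hr.ne'] at hpos

/-- For a valid PH representation `(α, T)` (with `T` Metzler and stable) and `γ > 0`,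
if `ω = 1 + γ α (T - γI)⁻¹ e < 1`, then `α₁ = (γ/(1-ω)) α (γI - T)⁻¹` is entrywise
nonnegative and sums to one, so `(α₁, T)` is a valid phase-type representation. -/
theorem alpha1_is_valid_ph (η : ℕ) (γ : ℝ) (hγ : 0 < γ)
    (T : Matrix (Fin η) (Fin η) ℝ)
    (hMetzler : ∀ i j : Fin η, i ≠ j → 0 ≤ T i j) (hT : NegStable T)
    (α : Fin η → ℝ) (hαnn : ∀ i, 0 ≤ α i) (hα : α ⬝ᵥ 1 = 1)
    (ω : ℝ)
    (hω : ω = 1 + γ * (α ⬝ᵥ ((T - γ • (1 : Matrix (Fin η) (Fin η) ℝ))⁻¹).mulVec 1))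
    (hω1 : ω < 1)
    (α₁ : Fin η → ℝ)
    (hα₁ : α₁ = (γ / (1 - ω)) •
      Matrix.vecMul α ((γ • (1 : Matrix (Fin η) (Fin η) ℝ) - T)⁻¹)) :
    (∀ i, 0 ≤ α₁ i) ∧ α₁ ⬝ᵥ 1 = 1 := by
  set R := (γ • (1 : Matrix (Fin η) (Fin η) ℝ) - T)⁻¹ with hR
  have hinv : (T - γ • (1 : Matrix (Fin η) (Fin η) ℝ))⁻¹ = -R := by
    rw [hR, ← neg_sub]
    refine Matrix.inv_eq_left_inv ?_
    rw [neg_mul_neg]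
    exact Matrix.nonsing_inv_mul _ (hT.det_smul_one_sub_ne_zero hγ.le).isUnit
  have hω' : 1 - ω = γ * (α ⬝ᵥ R *ᵥ 1) := by
    rw [hω, hinv, Matrix.neg_mulVec, dotProduct_neg]
    ring
  have hpos : 0 < 1 - ω := sub_pos.2 hω1
  subst hα₁
  constructor
  · intro i
    refine mul_nonneg (div_pos hγ hpos).le ?_
    simp only [Matrix.vecMul, dotProduct]
    exact Finset.sum_nonneg fun j _ =>
      mul_nonneg (hαnn j) (hT.resolvent_nonneg hMetzler hγ.le j i)
  · rw [smul_dotProduct, ← Matrix.dotProduct_mulVec, smul_eq_mul, div_mul_eq_mul_div, ← hω',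
      div_self hpos.ne']
end

section
/- Let L₀, L₁ be m×m real matrices, let P(n,·), n ∈ ℕ, be a family of counting kernels for the MSP (L₀, L₁), and let μ be a Borel probability measure on [0,∞) with finite positive mean 1/λ. Define S_n = ∫ P(n,t) dμ(t) and Ω_n = λ ∫₀^∞ P(n,t) μ((t,∞)) dt (entrywise integrals, which converge). Then S₀ = I_m + (1/λ) Ω₀ L₀, and for every n ≥ 1, S_n = (1/λ) Ω_n L₀ + (1/λ) Ω_{n-1} L₁. -/
open MeasureTheory Matrix

/-- A family of counting kernels for a Markovian service process (MSP) with representation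
`(L₀, L₁)`: continuously differentiable (on `[0,∞)`) nonnegative matrix functions `P n`
with `P 0 0 = I`, `P n 0 = 0` for `n ≥ 1`, satisfying the Kolmogorov forward equations
`(d/dt) P 0 t = P 0 t * L₀` and `(d/dt) P n t = P n t * L₀ + P (n-1) t * L₁` for `n ≥ 1`,
and total mass at most one from every initial phase. -/
structure MSPCountingKernel (m : ℕ) (L0 L1 : Matrix (Fin m) (Fin m) ℝ) where
  P : ℕ → ℝ → Matrix (Fin m) (Fin m) ℝ
  nonneg : ∀ n : ℕ, ∀ t : ℝ, 0 ≤ t → ∀ i j, 0 ≤ P n t i j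
  init_zero : P 0 0 = 1
  init_pos : ∀ n : ℕ, 1 ≤ n → P n 0 = 0
  continuousOn : ∀ n : ℕ, ∀ i j, ContinuousOn (fun t => P n t i j) (Set.Ici 0)
  hasDeriv_zero : ∀ t : ℝ, 0 ≤ t → ∀ i j,
    HasDerivWithinAt (fun s => P 0 s i j) ((P 0 t * L0) i j) (Set.Ici 0) t
  hasDeriv_pos : ∀ n : ℕ, 1 ≤ n → ∀ t : ℝ, 0 ≤ t → ∀ i j,
    HasDerivWithinAt (fun s => P n s i j)
      ((P n t * L0 + P (n - 1) t * L1) i j) (Set.Ici 0) t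
  mass_summable : ∀ t : ℝ, 0 ≤ t → ∀ i, Summable (fun n : ℕ => ∑ j, P n t i j)
  mass_le_one : ∀ t : ℝ, 0 ≤ t → ∀ i, (∑' n : ℕ, ∑ j, P n t i j) ≤ 1

/-- The integrand `g t` on `{(x, t) | t < x}` is integrable for the product of a law `μ` with finite
mean on `[0,∞)` and Lebesgue measure on `(0,∞)`, when `g` is continuous and bounded. -/
lemma integrable_prod_indicator_lt {μ : Measure ℝ} [IsProbabilityMeasure μ]
    (hpos : ∀ᵐ x ∂μ, 0 ≤ x) (hint : Integrable (fun t : ℝ => t) μ)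
    {g : ℝ → ℝ} (hg : ContinuousOn g (Set.Ici 0)) {C : ℝ} (hC : ∀ t, 0 ≤ t → |g t| ≤ C) :
    Integrable (fun p : ℝ × ℝ => (Set.Iio p.1).indicator g p.2)
      (μ.prod (volume.restrict (Set.Ioi (0 : ℝ)))) := by
  have hgm : AEStronglyMeasurable g (volume.restrict (Set.Ioi (0 : ℝ))) :=
    (hg.mono Set.Ioi_subset_Ici_self).aestronglyMeasurable measurableSet_Ioi
  have hm : AEStronglyMeasurable (fun p : ℝ × ℝ => (Set.Iio p.1).indicator g p.2)
      (μ.prod (volume.restrict (Set.Ioi (0 : ℝ)))) :=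
    (hgm.comp_snd (μ := μ)).indicator (measurableSet_lt measurable_snd measurable_fst)
  have hslice : ∀ x : ℝ, IntegrableOn g (Set.Ioo 0 x) := fun x =>
    ((hg.mono Set.Icc_subset_Ici_self).integrableOn_Icc).mono_set Set.Ioo_subset_Icc_self
  have hslice' : ∀ x : ℝ, Integrable ((Set.Iio x).indicator g)
      (volume.restrict (Set.Ioi (0 : ℝ))) := fun x => by
    rw [integrable_indicator_iff measurableSet_Iio, IntegrableOn,
      Measure.restrict_restrict measurableSet_Iio, Set.inter_comm]
    exact hslice x
  rw [integrable_prod_iff hm]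
  refine ⟨Filter.Eventually.of_forall hslice', ?_⟩
  refine (hint.const_mul C).mono' hm.norm.integral_prod_right' ?_
  filter_upwards [hpos] with x hx
  rw [Real.norm_of_nonneg (integral_nonneg fun t => norm_nonneg _)]
  simp_rw [norm_indicator_eq_indicator_norm]
  rw [setIntegral_indicator measurableSet_Iio, Set.Ioi_inter_Iio]
  calc ∫ t in Set.Ioo 0 x, ‖g t‖ ≤ ∫ _ in Set.Ioo 0 x, C :=
        setIntegral_mono_on (hslice x).norm (integrableOn_const (by simp)) measurableSet_Ioo
          fun t ht => hC t ht.1.le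
    _ = C * x := by simp [hx, mul_comm]

/-- Integrating first over `x` turns the indicator of `{t < x}` into the tail of `μ`. -/
lemma integral_indicator_lt_eq_mul_tail (μ : Measure ℝ) (g : ℝ → ℝ) (t : ℝ) :
    ∫ x, (Set.Iio x).indicator g t ∂μ = g t * (μ (Set.Ioi t)).toReal := by
  have : (fun x : ℝ => (Set.Iio x).indicator g t) = (Set.Ioi t).indicator fun _ => g t := by
    ext x
    simp [Set.indicator_apply]
  rw [this, integral_indicator_const _ measurableSet_Ioi, smul_eq_mul, mul_comm]
  rfl

lemma integrableOn_mul_tail {μ : Measure ℝ} [IsProbabilityMeasure μ]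
    (hpos : ∀ᵐ x ∂μ, 0 ≤ x) (hint : Integrable (fun t : ℝ => t) μ)
    {g : ℝ → ℝ} (hg : ContinuousOn g (Set.Ici 0)) {C : ℝ} (hC : ∀ t, 0 ≤ t → |g t| ≤ C) :
    IntegrableOn (fun t => g t * (μ (Set.Ioi t)).toReal) (Set.Ioi (0 : ℝ)) := by
  have h := (integrable_prod_indicator_lt hpos hint hg hC).integral_prod_right
  simpa only [integral_indicator_lt_eq_mul_tail, IntegrableOn] using h

/-- Integration by parts against a law on `[0,∞)` with finite mean. -/
lemma integral_eq_add_integral_deriv_mul_tail {μ : Measure ℝ} [IsProbabilityMeasure μ]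
    (hpos : ∀ᵐ x ∂μ, 0 ≤ x) (hint : Integrable (fun t : ℝ => t) μ)
    {f g : ℝ → ℝ} (hf : ∀ t, 0 ≤ t → HasDerivWithinAt f (g t) (Set.Ici 0) t)
    (hg : ContinuousOn g (Set.Ici 0)) {C : ℝ} (hC : ∀ t, 0 ≤ t → |g t| ≤ C) :
    ∫ x, f x ∂μ = f 0 + ∫ t in Set.Ioi (0 : ℝ), g t * (μ (Set.Ioi t)).toReal := by
  have hI := integrable_prod_indicator_lt hpos hint hg hC
  have hftc : ∀ᵐ x ∂μ, f x = f 0 + ∫ t in Set.Ioi (0 : ℝ), (Set.Iio x).indicator g t := by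
    filter_upwards [hpos] with x hx
    have hcont : ContinuousOn f (Set.Icc 0 x) := fun t ht =>
      (hf t ht.1).continuousWithinAt.mono Set.Icc_subset_Ici_self
    have hgi : IntervalIntegrable g volume 0 x :=
      (hg.mono (by rw [Set.uIcc_of_le hx]; exact Set.Icc_subset_Ici_self)).intervalIntegrable
    have h := intervalIntegral.integral_eq_sub_of_hasDerivAt_of_le hx hcont
      (fun t ht => (hf t ht.1.le).hasDerivAt (Ici_mem_nhds ht.1)) hgi
    rw [setIntegral_indicator measurableSet_Iio, Set.Ioi_inter_Iio,
      ← integral_Ioc_eq_integral_Ioo, ← intervalIntegral.integral_of_le hx, h]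
    ring
  rw [integral_congr_ae hftc, integral_add (integrable_const _) hI.integral_prod_left,
    integral_const, probReal_univ, one_smul, integral_integral_swap hI]
  simp only [integral_indicator_lt_eq_mul_tail]

namespace MSPCountingKernel

variable {m : ℕ} {L0 L1 : Matrix (Fin m) (Fin m) ℝ} (K : MSPCountingKernel m L0 L1)

lemma abs_le_one (n : ℕ) (i j : Fin m) (t : ℝ) (ht : 0 ≤ t) : |K.P n t i j| ≤ 1 := by
  rw [abs_of_nonneg (K.nonneg n t ht i j)]
  calc K.P n t i j ≤ ∑ k, K.P n t i k :=
        Finset.single_le_sum (fun k _ => K.nonneg n t ht i k) (Finset.mem_univ j)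
    _ ≤ ∑' n : ℕ, ∑ k, K.P n t i k :=
        (K.mass_summable t ht i).le_tsum n
          fun _ _ => Finset.sum_nonneg fun k _ => K.nonneg _ t ht i k
    _ ≤ 1 := K.mass_le_one t ht i

lemma continuousOn_mul (n : ℕ) (L : Matrix (Fin m) (Fin m) ℝ) (i j : Fin m) :
    ContinuousOn (fun t => (K.P n t * L) i j) (Set.Ici 0) := by
  simp only [Matrix.mul_apply]
  exact continuousOn_finsetSum _ fun k _ => (K.continuousOn n i k).mul continuousOn_const

lemma abs_mul_le (n : ℕ) (L : Matrix (Fin m) (Fin m) ℝ) (i j : Fin m) (t : ℝ) (ht : 0 ≤ t) :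
    |(K.P n t * L) i j| ≤ ∑ k, |L k j| := by
  rw [Matrix.mul_apply]
  refine (Finset.abs_sum_le_sum_abs _ _).trans (Finset.sum_le_sum fun k _ => ?_)
  rw [abs_mul]
  exact mul_le_of_le_one_left (abs_nonneg _) (K.abs_le_one n i k t ht)

lemma integrable {μ : Measure ℝ} [IsProbabilityMeasure μ] (hpos : ∀ᵐ x ∂μ, 0 ≤ x)
    (n : ℕ) (i j : Fin m) : Integrable (fun t => K.P n t i j) μ := by
  have hm : AEStronglyMeasurable (fun t => K.P n t i j) (μ.restrict (Set.Ici 0)) :=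
    (K.continuousOn n i j).aestronglyMeasurable measurableSet_Ici
  rw [Measure.restrict_eq_self_of_ae_mem (s := Set.Ici 0) hpos] at hm
  refine Integrable.of_bound hm 1 ?_
  filter_upwards [hpos] with t ht using K.abs_le_one n i j t ht

lemma integral_mul_mul_tail {μ : Measure ℝ} [IsProbabilityMeasure μ] (hpos : ∀ᵐ x ∂μ, 0 ≤ x)
    (hint : Integrable (fun t : ℝ => t) μ) (n : ℕ) (L : Matrix (Fin m) (Fin m) ℝ)
    (i j : Fin m) :
    ∫ t in Set.Ioi (0 : ℝ), (K.P n t * L) i j * (μ (Set.Ioi t)).toReal =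
      ∑ k, (∫ t in Set.Ioi (0 : ℝ), K.P n t i k * (μ (Set.Ioi t)).toReal) * L k j := by
  simp_rw [Matrix.mul_apply, Finset.sum_mul, mul_right_comm _ (L _ j)]
  rw [integral_finsetSum _ fun k _ => (integrableOn_mul_tail hpos hint (K.continuousOn n i k)
    (K.abs_le_one n i k)).mul_const _]
  simp_rw [integral_mul_const]

end MSPCountingKernel

/-- For an MSP counting kernel family and an inter-arrival distribution `μ` on `[0,∞)` with
finite positive mean `1/λ`, the matrices `Sₙ = ∫ P(n,t) dμ(t)` and
`Ωₙ = λ ∫₀^∞ P(n,t) μ((t,∞)) dt` exist entrywise and satisfy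
`S₀ = I + (1/λ) Ω₀ L₀` and `Sₙ = (1/λ) Ωₙ L₀ + (1/λ) Ωₙ₋₁ L₁` for `n ≥ 1`. -/
theorem S_Omega_relation (m : ℕ) (L0 L1 : Matrix (Fin m) (Fin m) ℝ)
    (K : MSPCountingKernel m L0 L1)
    (μ : Measure ℝ) [IsProbabilityMeasure μ] (hsupp : μ (Set.Iio 0) = 0)
    (lam : ℝ) (hlam : 0 < lam) (hint : Integrable (fun t : ℝ => t) μ)
    (hmean : (∫ t, t ∂μ) = 1 / lam)
    (S : ℕ → Matrix (Fin m) (Fin m) ℝ)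
    (hS : ∀ n : ℕ, S n = Matrix.of fun i j => ∫ t, K.P n t i j ∂μ)
    (Ω : ℕ → Matrix (Fin m) (Fin m) ℝ)
    (hΩ : ∀ n : ℕ, Ω n = Matrix.of fun i j =>
      lam * ∫ t in Set.Ioi (0 : ℝ), K.P n t i j * (μ (Set.Ioi t)).toReal) :
    (∀ n : ℕ, ∀ i j, Integrable (fun t => K.P n t i j) μ) ∧
    (∀ n : ℕ, ∀ i j, IntegrableOn
      (fun t => K.P n t i j * (μ (Set.Ioi t)).toReal) (Set.Ioi (0 : ℝ))) ∧
    S 0 = 1 + lam⁻¹ • (Ω 0 * L0) ∧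
    (∀ n : ℕ, 1 ≤ n → S n = lam⁻¹ • (Ω n * L0) + lam⁻¹ • (Ω (n - 1) * L1)) := by
  have hpos : ∀ᵐ x ∂μ, 0 ≤ x := by
    rw [ae_iff]
    simp only [not_le]
    exact hsupp
  have hcancel : ∀ (n : ℕ) (L : Matrix (Fin m) (Fin m) ℝ) (i j : Fin m),
      (lam⁻¹ • (Ω n * L)) i j =
        ∫ t in Set.Ioi (0 : ℝ), (K.P n t * L) i j * (μ (Set.Ioi t)).toReal := by
    intro n L i j
    rw [K.integral_mul_mul_tail hpos hint, Matrix.smul_apply, Matrix.mul_apply, hΩ, smul_eq_mul,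
      Finset.mul_sum]
    refine Finset.sum_congr rfl fun k _ => ?_
    rw [Matrix.of_apply, mul_assoc, inv_mul_cancel_left₀ hlam.ne']
  refine ⟨K.integrable hpos, fun n i j => integrableOn_mul_tail hpos hint (K.continuousOn n i j)
    (K.abs_le_one n i j), ?_, fun n hn => ?_⟩
  · ext i j
    rw [Matrix.add_apply, hcancel, hS, Matrix.of_apply,
      integral_eq_add_integral_deriv_mul_tail hpos hint (fun t ht => K.hasDeriv_zero t ht i j)
        (K.continuousOn_mul 0 L0 i j) (K.abs_mul_le 0 L0 i j), K.init_zero]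
  · ext i j
    rw [Matrix.add_apply, hcancel, hcancel, hS, Matrix.of_apply,
      integral_eq_add_integral_deriv_mul_tail hpos hint (fun t ht => K.hasDeriv_pos n hn t ht i j)
        ((K.continuousOn_mul n L0 i j).add (K.continuousOn_mul (n - 1) L1 i j))
        (fun t ht => (abs_add_le _ _).trans
          (add_le_add (K.abs_mul_le n L0 i j t ht) (K.abs_mul_le (n - 1) L1 i j t ht))),
      K.init_pos n hn, Matrix.zero_apply, zero_add]
    simp_rw [Matrix.add_apply, add_mul]
    exact integral_add
      (integrableOn_mul_tail hpos hint (K.continuousOn_mul n L0 i j) (K.abs_mul_le n L0 i j))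
      (integrableOn_mul_tail hpos hint (K.continuousOn_mul (n - 1) L1 i j)
        (K.abs_mul_le (n - 1) L1 i j))
end

section
/- Let L₀, L₁ be m×m real matrices with L₀ invertible, let P(n,·), n ∈ ℕ, be a family of counting kernels for the MSP (L₀, L₁), and let P̃(n,·), n ≥ 1, be continuously differentiable m×m matrix functions with entries in [0,1] satisfying P̃(n,0) = 0 and (d/dt)P̃(n,t) = P(n-1,t) L₁. Then for every n ≥ 1 and every t ≥ 0, P̃(n+1, t) = (P̃(n,t) - P(n,t)) (-L₀)^{-1} L₁. Consequently, for any Borel probability measure μ on [0,∞) with finite positive mean 1/λ₁, setting Δ_n = λ₁ ∫₀^∞ P(n,t) μ((t,∞)) dt and Δ_n* = λ₁ ∫₀^∞ P̃(n,t) μ((t,∞)) dt, one has Δ_{n+1}* = (Δ_n* - Δ_n)(-L₀)^{-1} L₁ for all n ≥ 1. -/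
open MeasureTheory Matrix

/-- A real function on `[0,∞)` vanishing at `0` with zero derivative is zero. -/
lemma eq_zero_of_hasDerivWithinAt_Ici_zero {f : ℝ → ℝ}
    (hf : ∀ t : ℝ, 0 ≤ t → HasDerivWithinAt f 0 (Set.Ici 0) t) (h0 : f 0 = 0)
    {t : ℝ} (ht : 0 ≤ t) : f t = 0 := by
  rw [← h0]
  refine constant_of_has_deriv_right_zero (a := 0) (b := t) (fun x hx => ?_) (fun x hx => ?_)
    t ⟨ht, le_rfl⟩
  · exact (hf x hx.1).continuousWithinAt.mono fun y hy => hy.1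
  · exact (hf x hx.1).mono fun y hy => hx.1.trans hy

/-- The tail of a probability measure on `[0,∞)` with finite mean is integrable. -/
lemma integrableOn_measure_Ioi_toReal (μ : Measure ℝ) [IsProbabilityMeasure μ]
    (hμ : μ (Set.Iio 0) = 0) (hint : Integrable (fun t : ℝ => t) μ) :
    IntegrableOn (fun t : ℝ => (μ (Set.Ioi t)).toReal) (Set.Ioi 0) := by
  have hnonneg : 0 ≤ᵐ[μ] fun t : ℝ => t := by
    rw [Filter.EventuallyLE, ae_iff]
    convert hμ using 2
    ext t
    simp
  have htail := lintegral_eq_lintegral_meas_lt μ hnonneg hint.aemeasurable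
  have hanti : Antitone fun t : ℝ => μ (Set.Ioi t) :=
    fun a b hab => measure_mono (Set.Ioi_subset_Ioi hab)
  refine integrable_toReal_of_lintegral_ne_top hanti.measurable.aemeasurable ?_
  have hfin := hint.lintegral_lt_top
  rw [htail] at hfin
  exact hfin.ne

/-- A continuous function on `[0,∞)` with values in `[0,1]` is integrable against an integrable
weight. -/
lemma integrableOn_continuousOn_Icc_mul {f w : ℝ → ℝ} (hw : IntegrableOn w (Set.Ioi 0))
    (hf : ContinuousOn f (Set.Ici 0)) (hf01 : ∀ t : ℝ, 0 ≤ t → f t ∈ Set.Icc (0 : ℝ) 1) :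
    IntegrableOn (fun t => f t * w t) (Set.Ioi 0) := by
  refine Integrable.bdd_mul (c := 1) hw
    ((hf.mono Set.Ioi_subset_Ici_self).aestronglyMeasurable measurableSet_Ioi) ?_
  filter_upwards [ae_restrict_mem measurableSet_Ioi] with t ht
  have h := hf01 t (Set.mem_Ioi.1 ht).le
  rw [Real.norm_of_nonneg h.1]
  exact h.2

/-- The entries of a counting kernel lie in `[0,1]`. -/
lemma MSPCountingKernel.mem_Icc {m : ℕ} {L0 L1 : Matrix (Fin m) (Fin m) ℝ}
    (K : MSPCountingKernel m L0 L1) (n : ℕ) {t : ℝ} (ht : 0 ≤ t) (i j : Fin m) :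
    K.P n t i j ∈ Set.Icc (0 : ℝ) 1 := by
  refine ⟨K.nonneg n t ht i j, ?_⟩
  calc K.P n t i j ≤ ∑ k, K.P n t i k :=
        Finset.single_le_sum (fun k _ => K.nonneg n t ht i k) (Finset.mem_univ j)
    _ ≤ ∑' l : ℕ, ∑ k, K.P l t i k :=
        (K.mass_summable t ht i).le_tsum n
          fun l _ => Finset.sum_nonneg fun k _ => K.nonneg l t ht i k
    _ ≤ 1 := K.mass_le_one t ht i

/-- The pointwise recursion `P̃(n+1,t) = (P̃(n,t) - P(n,t))(-L₀)⁻¹ L₁`. -/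
lemma MSPCountingKernel.Ptilde_succ {m : ℕ} {L0 L1 : Matrix (Fin m) (Fin m) ℝ}
    (hL0 : IsUnit L0.det) (K : MSPCountingKernel m L0 L1)
    {Pt : ℕ → ℝ → Matrix (Fin m) (Fin m) ℝ}
    (hPt0 : ∀ n : ℕ, 1 ≤ n → Pt n 0 = 0)
    (hPtderiv : ∀ n : ℕ, 1 ≤ n → ∀ t : ℝ, 0 ≤ t → ∀ i j,
      HasDerivWithinAt (fun s => Pt n s i j) ((K.P (n - 1) t * L1) i j) (Set.Ici 0) t)
    {n : ℕ} (hn : 1 ≤ n) {t : ℝ} (ht : 0 ≤ t) :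
    Pt (n + 1) t = (Pt n t - K.P n t) * ((-L0)⁻¹ * L1) := by
  have hinv : -L0 * (-L0)⁻¹ = 1 :=
    Matrix.mul_nonsing_inv _ (by rw [Matrix.det_neg]; exact (IsUnit.pow _ isUnit_one.neg).mul hL0)
  ext i j
  set M := (-L0)⁻¹ * L1 with hM
  refine sub_eq_zero.1 (eq_zero_of_hasDerivWithinAt_Ici_zero
    (f := fun s => Pt (n + 1) s i j - ((Pt n s - K.P n s) * M) i j) (fun s hs => ?_) ?_ ht)
  · have hderiv : HasDerivWithinAt (fun s => ((Pt n s - K.P n s) * M) i j)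
        (∑ k, ((K.P (n - 1) s * L1) i k - (K.P n s * L0 + K.P (n - 1) s * L1) i k) * M k j)
        (Set.Ici 0) s := by
      simp only [Matrix.mul_apply (M := Pt n _ - K.P n _), Matrix.sub_apply]
      exact HasDerivWithinAt.fun_sum fun k _ =>
        ((hPtderiv n hn s hs i k).sub (K.hasDeriv_pos n hn s hs i k)).mul_const _
    have heq : ∑ k, ((K.P (n - 1) s * L1) i k
        - (K.P n s * L0 + K.P (n - 1) s * L1) i k) * M k j = (K.P n s * L1) i j := by
      have hmat : K.P n s * -L0 * M = K.P n s * L1 := by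
        rw [hM, Matrix.mul_assoc, ← Matrix.mul_assoc (-L0), hinv, Matrix.one_mul]
      rw [← hmat, Matrix.mul_apply]
      exact Finset.sum_congr rfl fun k _ => by simp
    have hsucc := hPtderiv (n + 1) (by omega) s hs i j
    rw [heq] at hderiv
    simpa using hsucc.fun_sub hderiv
  · simp [hPt0 n hn, hPt0 (n + 1) (by omega), K.init_pos n hn]

/-- For an MSP counting kernel family with `L₀` invertible and auxiliary kernels `P̃(n,·)`
(with `P̃(n,0) = 0` and `(d/dt)P̃(n,t) = P(n-1,t) L₁`), one has
`P̃(n+1,t) = (P̃(n,t) - P(n,t))(-L₀)⁻¹ L₁` for all `n ≥ 1`, `t ≥ 0`; consequently,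
integrating against the elapsed-time density `λ₁ μ((t,∞))` of any probability measure `μ`
on `[0,∞)` with finite positive mean `1/λ₁`, the matrices
`Δₙ = λ₁ ∫₀^∞ P(n,t) μ((t,∞)) dt` and `Δₙ* = λ₁ ∫₀^∞ P̃(n,t) μ((t,∞)) dt` satisfy
`Δₙ₊₁* = (Δₙ* - Δₙ)(-L₀)⁻¹ L₁` for all `n ≥ 1`. -/
theorem Ptilde_Deltastar_recursion (m : ℕ) (L0 L1 : Matrix (Fin m) (Fin m) ℝ)
    (hL0 : IsUnit L0.det) (K : MSPCountingKernel m L0 L1)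
    (Pt : ℕ → ℝ → Matrix (Fin m) (Fin m) ℝ)
    (hPt01 : ∀ n : ℕ, 1 ≤ n → ∀ t : ℝ, 0 ≤ t → ∀ i j, Pt n t i j ∈ Set.Icc (0:ℝ) 1)
    (hPt0 : ∀ n : ℕ, 1 ≤ n → Pt n 0 = 0)
    (hPtderiv : ∀ n : ℕ, 1 ≤ n → ∀ t : ℝ, 0 ≤ t → ∀ i j,
      HasDerivWithinAt (fun s => Pt n s i j) ((K.P (n - 1) t * L1) i j) (Set.Ici 0) t) :
    (∀ n : ℕ, 1 ≤ n → ∀ t : ℝ, 0 ≤ t →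
        Pt (n + 1) t = (Pt n t - K.P n t) * (-L0)⁻¹ * L1) ∧
    ∀ (μ : Measure ℝ), IsProbabilityMeasure μ → μ (Set.Iio 0) = 0 →
      ∀ lam1 : ℝ, 0 < lam1 → Integrable (fun t : ℝ => t) μ →
        (∫ t, t ∂μ) = 1 / lam1 →
        ∀ (Δ Δstar : ℕ → Matrix (Fin m) (Fin m) ℝ),
          (∀ n : ℕ, Δ n = Matrix.of fun i j =>
            lam1 * ∫ t in Set.Ioi (0 : ℝ), K.P n t i j * (μ (Set.Ioi t)).toReal) →
          (∀ n : ℕ, Δstar n = Matrix.of fun i j =>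
            lam1 * ∫ t in Set.Ioi (0 : ℝ), Pt n t i j * (μ (Set.Ioi t)).toReal) →
          ∀ n : ℕ, 1 ≤ n → Δstar (n + 1) = (Δstar n - Δ n) * (-L0)⁻¹ * L1 := by
  have hrec : ∀ n : ℕ, 1 ≤ n → ∀ t : ℝ, 0 ≤ t →
      Pt (n + 1) t = (Pt n t - K.P n t) * ((-L0)⁻¹ * L1) :=
    fun n hn t ht => K.Ptilde_succ hL0 hPt0 hPtderiv hn ht
  refine ⟨fun n hn t ht => by rw [hrec n hn t ht, Matrix.mul_assoc], ?_⟩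
  intro μ _ hμ lam1 _ hint _ Δ Δstar hΔ hΔstar n hn
  have hw := integrableOn_measure_Ioi_toReal μ hμ hint
  have hP (k i) := integrableOn_continuousOn_Icc_mul hw (K.continuousOn n i k)
    fun t ht => K.mem_Icc n ht i k
  have hQ (k i) := integrableOn_continuousOn_Icc_mul hw
    (fun t ht => (hPtderiv n hn t ht i k).continuousWithinAt) fun t ht => hPt01 n hn t ht i k
  rw [Matrix.mul_assoc]
  ext i j
  set M := (-L0)⁻¹ * L1
  have hcongr : ∫ t in Set.Ioi (0 : ℝ), Pt (n + 1) t i j * (μ (Set.Ioi t)).toReal =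
      ∫ t in Set.Ioi (0 : ℝ), ∑ k, (Pt n t i k * (μ (Set.Ioi t)).toReal
        - K.P n t i k * (μ (Set.Ioi t)).toReal) * M k j := by
    refine setIntegral_congr_fun measurableSet_Ioi fun t ht => ?_
    simp only [hrec n hn t (Set.mem_Ioi.1 ht).le, Matrix.mul_apply, Matrix.sub_apply,
      Finset.sum_mul]
    exact Finset.sum_congr rfl fun k _ => by ring
  have hterm (k : Fin m) : IntegrableOn (fun t => (Pt n t i k * (μ (Set.Ioi t)).toReal
      - K.P n t i k * (μ (Set.Ioi t)).toReal) * M k j) (Set.Ioi 0) :=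
    ((hQ k i).sub (hP k i)).mul_const _
  rw [hΔstar (n + 1), Matrix.of_apply, hcongr,
    integral_finsetSum Finset.univ fun k _ => hterm k, Finset.mul_sum, Matrix.mul_apply]
  refine Finset.sum_congr rfl fun k _ => ?_
  rw [integral_mul_const, integral_sub (hQ k i) (hP k i), hΔ, hΔstar]
  simp only [Matrix.sub_apply, Matrix.of_apply]
  ring
end
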